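/- Let A ∈ ℝ^{n×n}, B ∈ ℝ^{n×p}, let Q ∈ ℝ^{n×n} be symmetric positive semidefinite with Q = FᵀF, let R ∈ ℝ^{p×p} be symmetric positive definite, and consider the algebraic Riccati equation X B R⁻¹ Bᵀ X − XA − AᵀX − Q = 0. Suppose (A, B) is stabilizable, suppose X₋ is a smallest positive semidefinite solution (a symmetric positive semidefinite solution with X₋ ≤ X̃ for every symmetric positive semidefinite solution X̃), and suppose X₊ is a maximal solution (a symmetric solution with X̃ ≤ X₊ for every symmetric solution X̃). Then X₋ = X₊ if and only if there is no nonzero vector v ∈ ℂⁿ and λ ∈ ℂ with Re λ > 0 such that Av = λv and Fv = 0. -/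

import Mathlib

open Matrix

/-- `(A, B)` is stabilizable if some state feedback `F'` places all complex eigenvalues of
`A + BF'` in the open left half-plane. -/
def Stabilizable {n p : ℕ} (A : Matrix (Fin n) (Fin n) ℝ) (B : Matrix (Fin n) (Fin p) ℝ) :
    Prop :=
  ∃ F' : Matrix (Fin p) (Fin n) ℝ,
    ∀ (μ : ℂ) (v : Fin n → ℂ), v ≠ 0 →
      ((A + B * F').map (Complex.ofReal)) *ᵥ v = μ • v → μ.re < 0

/-- `X` solves the algebraic Riccati equation `X B R⁻¹ Bᵀ X − XA − AᵀX − Q = 0`. -/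
def SolvesARE {n p : ℕ} (A : Matrix (Fin n) (Fin n) ℝ) (B : Matrix (Fin n) (Fin p) ℝ)
    (Q : Matrix (Fin n) (Fin n) ℝ) (R : Matrix (Fin p) (Fin p) ℝ)
    (X : Matrix (Fin n) (Fin n) ℝ) : Prop :=
  X * B * R⁻¹ * Bᵀ * X - X * A - Aᵀ * X - Q = 0

namespace RiccatiGap
variable {n ι : Type*} [Fintype n] [Fintype ι]

open scoped MatrixOrder in
theorem eq_zero_of_posSemidef_of_neg {l : Type*} {D : Matrix l l ℝ} (h : D.PosSemidef)
    (h' : (-D).PosSemidef) : D = 0 :=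
  le_antisymm (by rwa [Matrix.le_iff, zero_sub]) (by rwa [Matrix.le_iff, sub_zero])

theorem block_posSemidef [DecidableEq ι] {W : Matrix ι ι ℝ} (hW : W.PosDef) (Y : Matrix n ι ℝ) :
    (Y * W⁻¹ * Yᵀ).PosSemidef := by
  simpa using hW.inv.posSemidef.mul_mul_conjTranspose_same Y

theorem block_ne_zero [DecidableEq n] [DecidableEq ι] {W : Matrix ι ι ℝ} (hW : W.PosDef)
    {Y : Matrix n ι ℝ} (hY : Y ≠ 0) :
    Y * W⁻¹ * Yᵀ ≠ 0 := by
  intro h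
  apply hY
  have key : ∀ z, Yᵀ *ᵥ z = 0 := by
    intro z
    by_contra hz
    have h1 := hW.inv.dotProduct_mulVec_pos hz
    have h2 : star (Yᵀ *ᵥ z) ⬝ᵥ W⁻¹ *ᵥ (Yᵀ *ᵥ z) = z ⬝ᵥ (Y * W⁻¹ * Yᵀ) *ᵥ z := by
      rw [star_trivial, mulVec_transpose, ← dotProduct_mulVec, ← mulVec_transpose]
      simp [mulVec_mulVec, Matrix.mul_assoc]
    rw [h2, h] at h1
    simp at h1
  rw [← Matrix.transpose_eq_zero]
  exact Matrix.ext_of_mulVec_single fun i => by rw [key]; simp; rfl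

theorem block_quadratic [DecidableEq ι] {S M : Matrix n n ℝ} {Y : Matrix n ι ℝ} {W L : Matrix ι ι ℝ}
    (hW : W.PosDef) (hM : M * Y = Y * L) (hG : Yᵀ * S * Y = W * L + Lᵀ * W) :
    (Y * W⁻¹ * Yᵀ) * S * (Y * W⁻¹ * Yᵀ)
      = M * (Y * W⁻¹ * Yᵀ) + (Y * W⁻¹ * Yᵀ) * Mᵀ := by
  have hu : IsUnit W.det := (Matrix.isUnit_iff_isUnit_det _).1 hW.isUnit
  have hM' : Yᵀ * Mᵀ = Lᵀ * Yᵀ := by rw [← transpose_mul, hM, transpose_mul]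
  calc (Y * W⁻¹ * Yᵀ) * S * (Y * W⁻¹ * Yᵀ)
      = Y * W⁻¹ * (Yᵀ * S * Y) * W⁻¹ * Yᵀ := by simp only [Matrix.mul_assoc]
    _ = Y * (W⁻¹ * W) * L * W⁻¹ * Yᵀ + Y * W⁻¹ * Lᵀ * (W * W⁻¹) * Yᵀ := by
        rw [hG]; simp only [Matrix.mul_assoc, Matrix.mul_add, Matrix.add_mul]
    _ = (Y * L) * W⁻¹ * Yᵀ + Y * W⁻¹ * (Lᵀ * Yᵀ) := by
        rw [Matrix.nonsing_inv_mul _ hu, Matrix.mul_nonsing_inv _ hu]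
        simp only [Matrix.mul_assoc, Matrix.mul_one]
    _ = _ := by rw [← hM, ← hM']; simp only [Matrix.mul_assoc]

theorem schur_posSemidef [DecidableEq n] [DecidableEq ι] {X : Matrix n n ℝ} (hX : X.PosSemidef)
    {V : Matrix n ι ℝ} (hW : (Vᵀ * X * V).PosDef) :
    (X - (X * V) * (Vᵀ * X * V)⁻¹ * (X * V)ᵀ).PosSemidef := by
  have hu : IsUnit (Vᵀ * X * V).det := (Matrix.isUnit_iff_isUnit_det _).1 hW.isUnit
  have hXt : Xᵀ = X := by simpa using hX.1.eq
  have hWt : (Vᵀ * X * V)⁻¹ᵀ = (Vᵀ * X * V)⁻¹ := by simpa using hW.inv.1.eq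
  set W := Vᵀ * X * V with hWdef
  have h := hX.conjTranspose_mul_mul_same (1 - V * W⁻¹ * Vᵀ * X)
  convert h using 1
  have h3 : X * V * W⁻¹ * Vᵀ * X * (V * W⁻¹ * Vᵀ * X) = X * V * W⁻¹ * Vᵀ * X := by
    calc _ = X * V * W⁻¹ * (Vᵀ * X * V) * W⁻¹ * Vᵀ * X := by simp only [Matrix.mul_assoc]
      _ = X * V * (W⁻¹ * W) * W⁻¹ * Vᵀ * X := by rw [← hWdef]; simp only [Matrix.mul_assoc]
      _ = _ := by rw [Matrix.nonsing_inv_mul _ hu]; simp only [Matrix.mul_one]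
  have h4 : (1 - V * W⁻¹ * Vᵀ * X)ᵀ = 1 - X * V * W⁻¹ * Vᵀ := by
    simp only [transpose_sub, transpose_mul, transpose_one, transpose_transpose, hWt, hXt,
      Matrix.mul_assoc]
  rw [conjTranspose_eq_transpose_of_trivial, h4, transpose_mul, hXt]
  simp only [Matrix.sub_mul, Matrix.mul_sub, Matrix.one_mul, Matrix.mul_one, h3]
  simp only [← Matrix.mul_assoc, sub_self, sub_zero]

/-- The determinant criterion for a symmetric `2 × 2` matrix. -/
theorem posDef_two {x y z : ℝ} (hx : 0 < x) (hd : 0 < x * z - y ^ 2) :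
    (!![x, y; y, z] : Matrix (Fin 2) (Fin 2) ℝ).PosDef := by
  refine .of_dotProduct_mulVec_pos ?_ ?_
  · ext i j; fin_cases i <;> fin_cases j <;> simp
  · intro v hv
    have hv' : 0 < v 0 ^ 2 + v 1 ^ 2 := by
      by_contra hc
      apply hv
      have h0 : v 0 = 0 := by nlinarith [sq_nonneg (v 0), sq_nonneg (v 1)]
      have h1 : v 1 = 0 := by nlinarith [sq_nonneg (v 0), sq_nonneg (v 1)]
      ext i; fin_cases i <;> simp [h0, h1]
    have e : star v ⬝ᵥ !![x, y; y, z] *ᵥ v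
        = x * v 0 ^ 2 + 2 * y * (v 0 * v 1) + z * v 1 ^ 2 := by
      simp [dotProduct, mulVec, Fin.sum_univ_two]; ring
    rw [e]
    have hz : x * (x * v 0 ^ 2 + 2 * y * (v 0 * v 1) + z * v 1 ^ 2)
        = (x * v 0 + y * v 1) ^ 2 + (x * z - y ^ 2) * v 1 ^ 2 := by ring
    refine pos_of_mul_pos_right (a := x) ?_ hx.le
    rw [hz]
    by_cases h1 : v 1 = 0
    · have h0 : v 0 ≠ 0 := by rintro h0; simp [h0, h1] at hv'
      rw [h1]; simp; positivity
    · positivity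

theorem exists_lyapunov_two {g h k a b : ℝ} (ha : 0 < a) (hb : b ≠ 0) (ht : 0 < g + k)
    (hd : 0 ≤ g * k - h ^ 2) :
    ∃ W : Matrix (Fin 2) (Fin 2) ℝ, W.PosDef ∧
      !![g, h; h, k] = W * !![a, b; -b, a] + !![a, b; -b, a]ᵀ * W := by
  set t := (g + k) / (2 * a) with htd
  set d := (a * ((g - k) / 2) + b * h) / (a ^ 2 + b ^ 2) with hdd
  set e := (a * h - b * ((g - k) / 2)) / (a ^ 2 + b ^ 2) with hed
  have hab : a ^ 2 + b ^ 2 ≠ 0 := by positivity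
  have ht' : 0 < t := by positivity
  have h1 : a * d - b * e = (g - k) / 2 := by rw [hdd, hed]; field_simp; ring
  have h2 : a * e + b * d = h := by rw [hdd, hed]; field_simp; ring
  have h3 : 2 * a * t = g + k := by rw [htd]; field_simp
  have hdet : 0 < t ^ 2 - d ^ 2 - e ^ 2 := by
    have h4 : (a ^ 2 + b ^ 2) * (d ^ 2 + e ^ 2) = ((g - k) / 2) ^ 2 + h ^ 2 := by
      rw [← h1, ← h2]; ring
    have h5 : ((g - k) / 2) ^ 2 + h ^ 2 ≤ a ^ 2 * t ^ 2 := by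
      have : a ^ 2 * t ^ 2 = ((g + k) / 2) ^ 2 := by rw [← h3]; ring
      rw [this]; nlinarith
    have h6 : 0 < b ^ 2 * t ^ 2 := by positivity
    have h7 : (a ^ 2 + b ^ 2) * (d ^ 2 + e ^ 2) < (a ^ 2 + b ^ 2) * t ^ 2 := by
      rw [h4]; nlinarith
    have := lt_of_mul_lt_mul_left h7 (by positivity)
    linarith
  have htd' : 0 < t + d := by
    have : d ^ 2 < t ^ 2 := by nlinarith [sq_nonneg e]
    have := abs_lt_of_sq_lt_sq this ht'.le
    linarith [(abs_lt.1 this).1]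
  refine ⟨!![(t + d) / 2, e / 2; e / 2, (t - d) / 2], posDef_two (by positivity) ?_, ?_⟩
  · nlinarith
  · ext i j
    fin_cases i <;> fin_cases j <;> simp [Matrix.mul_apply, Fin.sum_univ_two] <;> linarith

theorem posDef_gram_of_injective {X : Matrix n n ℝ} (hX : X.PosSemidef) {V : Matrix n ι ℝ}
    (hV : ∀ c : ι → ℝ, (X * V) *ᵥ c = 0 → c = 0) : (Vᵀ * X * V).PosDef := by
  have hp : (Vᵀ * X * V).PosSemidef := by simpa using hX.conjTranspose_mul_mul_same V
  refine .of_dotProduct_mulVec_pos hp.1 fun c hc => (hp.dotProduct_mulVec_nonneg c).lt_of_ne ?_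
  intro h0
  have h : star (V *ᵥ c) ⬝ᵥ X *ᵥ (V *ᵥ c) = 0 := by
    rw [h0, star_trivial, star_trivial, ← mulVec_mulVec, ← mulVec_mulVec,
      dotProduct_mulVec c, vecMul_transpose]
  rw [hX.dotProduct_mulVec_zero_iff, mulVec_mulVec] at h
  exact hc (hV c h)

/-- The matrix with columns `y` and `z`. -/
def twoCol {l : Type*} (y z : l → ℝ) : Matrix l (Fin 2) ℝ := (Matrix.of ![y, z])ᵀ

theorem mul_twoCol {m : Type*} (M : Matrix m n ℝ) (y z : n → ℝ) :
    M * twoCol y z = twoCol (M *ᵥ y) (M *ᵥ z) := by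
  ext i j
  fin_cases j <;> rfl

theorem twoCol_mul {l : Type*} (y z : l → ℝ) (a b c d : ℝ) :
    twoCol y z * !![a, b; c, d] = twoCol (a • y + c • z) (b • y + d • z) := by
  ext i j
  fin_cases j <;> simp [twoCol, Matrix.mul_apply, Fin.sum_univ_two] <;> ring

theorem twoCol_mulVec {l : Type*} (y z : l → ℝ) (c : Fin 2 → ℝ) :
    twoCol y z *ᵥ c = c 0 • y + c 1 • z := by
  ext i
  simp [twoCol, mulVec, dotProduct, Fin.sum_univ_two]; ring

theorem twoCol_gram (S : Matrix n n ℝ) (y z : n → ℝ) :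
    (twoCol y z)ᵀ * S * twoCol y z =
      !![y ⬝ᵥ S *ᵥ y, y ⬝ᵥ S *ᵥ z; z ⬝ᵥ S *ᵥ y, z ⬝ᵥ S *ᵥ z] := by
  rw [Matrix.mul_assoc, mul_twoCol]
  ext i j
  fin_cases i <;> fin_cases j <;> rfl

theorem twoCol_eq_zero {l : Type*} {y z : l → ℝ} (h : twoCol y z = 0) : y = 0 ∧ z = 0 :=
  ⟨funext fun i => congr_fun (congr_fun h i) 0, funext fun i => congr_fun (congr_fun h i) 1⟩

theorem exists_quadratic_of_eigenvector [DecidableEq n] {S M : Matrix n n ℝ} (hS : S.PosSemidef) {y : n → ℝ}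
    {a : ℝ} (ha : 0 < a) (hy : M *ᵥ y = a • y) (hSy : S *ᵥ y ≠ 0) :
    ∃ D : Matrix n n ℝ, D.PosSemidef ∧ D ≠ 0 ∧ D * S * D = M * D + D * Mᵀ := by
  have hs : 0 < y ⬝ᵥ S *ᵥ y := (hS.dotProduct_mulVec_nonneg y).lt_of_ne fun h =>
    hSy ((hS.dotProduct_mulVec_zero_iff y).1 h.symm)
  have hW : (((y ⬝ᵥ S *ᵥ y) / (2 * a)) • (1 : Matrix (Fin 1) (Fin 1) ℝ)).PosDef :=
    Matrix.PosDef.one.smul (by positivity)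
  refine ⟨_, block_posSemidef hW (replicateCol (Fin 1) y), block_ne_zero hW ?_,
    block_quadratic (L := a • 1) hW ?_ ?_⟩
  · intro h
    exact hSy (by rw [show y = 0 from funext fun i => congr_fun (congr_fun h i) 0, mulVec_zero])
  · rw [← replicateCol_mulVec, hy]; ext; simp
  · rw [Matrix.mul_assoc, ← replicateCol_mulVec]
    ext i j
    have : (replicateCol (Fin 1) y)ᵀ * replicateCol (Fin 1) (S *ᵥ y)
      = Matrix.of fun _ _ => y ⬝ᵥ S *ᵥ y := rfl
    rw [this]
    fin_cases i; fin_cases j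
    simp; field_simp; ring

/-- A nonzero positive semidefinite solution of `D S D = M D + D Mᵀ` built from a real
invariant pair of `M` whose eigenvalue `a + b i` lies in the open right half-plane. -/
theorem exists_quadratic_of_pair [DecidableEq n] {S M : Matrix n n ℝ} (hS : S.PosSemidef) {y z : n → ℝ}
    {a b : ℝ} (ha : 0 < a) (hy : M *ᵥ y = a • y - b • z) (hz : M *ᵥ z = b • y + a • z)
    (hne : ¬(S *ᵥ y = 0 ∧ S *ᵥ z = 0)) :
    ∃ D : Matrix n n ℝ, D.PosSemidef ∧ D ≠ 0 ∧ D * S * D = M * D + D * Mᵀ := by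
  rcases eq_or_ne b 0 with rfl | hb
  · by_cases h : S *ᵥ y = 0
    · exact exists_quadratic_of_eigenvector hS ha (y := z) (by simpa using hz)
        fun h' => hne ⟨h, h'⟩
    · exact exists_quadratic_of_eigenvector hS ha (y := y) (by simpa using hy) h
  have h0 := hS.dotProduct_mulVec_nonneg
  simp only [star_trivial] at h0
  have hG : ((twoCol y z)ᵀ * S * twoCol y z).PosSemidef := by
    simpa using hS.conjTranspose_mul_mul_same (twoCol y z)
  have hsymm : z ⬝ᵥ S *ᵥ y = y ⬝ᵥ S *ᵥ z := by
    have := hG.1.apply 0 1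
    rw [twoCol_gram] at this
    simpa using this
  have hdet := hG.det_nonneg
  rw [twoCol_gram, Matrix.det_fin_two_of, hsymm] at hdet
  have htr : 0 < y ⬝ᵥ S *ᵥ y + z ⬝ᵥ S *ᵥ z := by
    refine (add_nonneg (h0 y) (h0 z)).lt_of_ne fun h => hne ?_
    constructor
    · exact (hS.dotProduct_mulVec_zero_iff y).1 (by simp; linarith [h0 y, h0 z])
    · exact (hS.dotProduct_mulVec_zero_iff z).1 (by simp; linarith [h0 y, h0 z])
  obtain ⟨W, hW, hWG⟩ := exists_lyapunov_two ha hb htr (h := y ⬝ᵥ S *ᵥ z) (by linarith)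
  refine ⟨_, block_posSemidef hW (twoCol y z), block_ne_zero hW ?_,
    block_quadratic hW ?_ (by rw [twoCol_gram, hsymm, hWG])⟩
  · intro h
    obtain ⟨rfl, rfl⟩ := twoCol_eq_zero h
    simp at hne
  · rw [mul_twoCol, twoCol_mul, hy, hz]
    congr 1
    module

theorem exists_reduction_of_injective [DecidableEq n] [DecidableEq ι] {S A X Q : Matrix n n ℝ}
    (hX : X.PosSemidef) (hARE : X * S * X = X * A + Aᵀ * X + Q) {V : Matrix n ι ℝ} {L : Matrix ι ι ℝ}
    (hA : A * V = V * L) (hQ : Q * V = 0)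
    (hV : ∀ c : ι → ℝ, (X * V) *ᵥ c = 0 → c = 0) (hXV : X * V ≠ 0) :
    ∃ D : Matrix n n ℝ, D.PosSemidef ∧ D ≠ 0 ∧ (X - D).PosSemidef ∧
      D * S * D = (X * S - Aᵀ) * D + D * (X * S - Aᵀ)ᵀ := by
  have hW := posDef_gram_of_injective hX hV
  have hXt : Xᵀ = X := by simpa using hX.1.eq
  have hXS : X * S * X * V = X * V * L + Aᵀ * X * V := by
    rw [hARE]
    simp only [Matrix.add_mul, Matrix.mul_assoc, hA, hQ, add_zero]
  refine ⟨_, block_posSemidef hW (X * V), block_ne_zero hW hXV, schur_posSemidef hX hW,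
    block_quadratic (L := L) hW ?_ ?_⟩
  · rw [Matrix.sub_mul, sub_eq_iff_eq_add]
    simpa only [Matrix.mul_assoc] using hXS
  · have hA' : Vᵀ * Aᵀ = Lᵀ * Vᵀ := by rw [← transpose_mul, hA, transpose_mul]
    calc (X * V)ᵀ * S * (X * V) = Vᵀ * (X * S * X * V) := by
          rw [transpose_mul, hXt]; simp only [Matrix.mul_assoc]
      _ = Vᵀ * X * V * L + (Vᵀ * Aᵀ) * X * V := by
          rw [hXS, Matrix.mul_add]; simp only [Matrix.mul_assoc]
      _ = _ := by rw [hA']; simp only [Matrix.mul_assoc]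

theorem exists_reduction_of_pair [DecidableEq n] {S A X Q : Matrix n n ℝ}
    (hX : X.PosSemidef) (hARE : X * S * X = X * A + Aᵀ * X + Q) {y z : n → ℝ}
    {a b : ℝ} (hy : A *ᵥ y = a • y - b • z) (hz : A *ᵥ z = b • y + a • z)
    (hQy : Q *ᵥ y = 0) (hQz : Q *ᵥ z = 0)
    (hne : ¬(X *ᵥ y = 0 ∧ X *ᵥ z = 0)) :
    ∃ D : Matrix n n ℝ, D.PosSemidef ∧ D ≠ 0 ∧ (X - D).PosSemidef ∧
      D * S * D = (X * S - Aᵀ) * D + D * (X * S - Aᵀ)ᵀ := by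
  have single : ∀ v : n → ℝ, A *ᵥ v = a • v → Q *ᵥ v = 0 → X *ᵥ v ≠ 0 →
      ∃ D : Matrix n n ℝ, D.PosSemidef ∧ D ≠ 0 ∧ (X - D).PosSemidef ∧
        D * S * D = (X * S - Aᵀ) * D + D * (X * S - Aᵀ)ᵀ := by
    intro v hv hQv hXv
    have e : X * replicateCol (Fin 1) v = replicateCol (Fin 1) (X *ᵥ v) :=
      (replicateCol_mulVec _ _).symm
    refine exists_reduction_of_injective hX hARE (V := replicateCol (Fin 1) v) (L := a • 1)
      ?_ ?_ ?_ ?_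
    · rw [← replicateCol_mulVec, hv]; ext; simp
    · rw [← replicateCol_mulVec, hQv]; rfl
    · intro c hc
      have h1 : c 0 • (X *ᵥ v) = 0 := by
        rw [← hc, e]; ext i; simp [mulVec, dotProduct, mul_comm]
      have h2 := (smul_eq_zero.1 h1).resolve_right hXv
      ext i; fin_cases i; exact h2
    · rw [e]
      exact fun h => hXv (funext fun i => congr_fun (congr_fun h i) 0)
  rcases eq_or_ne b 0 with rfl | hb
  · by_cases h : X *ᵥ y = 0
    · exact single z (by simpa using hz) hQz fun h' => hne ⟨h, h'⟩
    · exact single y (by simpa using hy) hQy h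
  have hker : ∀ w : n → ℝ, Q *ᵥ w = 0 → X *ᵥ w = 0 → X *ᵥ (A *ᵥ w) = 0 := by
    intro w hQw hXw
    have h := congr_arg (· *ᵥ w) hARE
    simpa [add_mulVec, ← mulVec_mulVec, hQw, hXw] using h.symm
  refine exists_reduction_of_injective hX hARE (V := twoCol y z) (L := !![a, b; -b, a])
    ?_ ?_ ?_ ?_
  · rw [mul_twoCol, twoCol_mul, hy, hz]
    congr 1
    module
  · rw [mul_twoCol, hQy, hQz]
    ext i j; fin_cases j <;> rfl
  · intro c hc
    rw [mul_twoCol, twoCol_mulVec] at hc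
    have h1 := hker (c 0 • y + c 1 • z) (by simp [mulVec_add, mulVec_smul, hQy, hQz])
      (by simpa [mulVec_add, mulVec_smul] using hc)
    simp only [mulVec_add, mulVec_smul, mulVec_sub, hy, hz] at h1
    have h2 : b • (c 1 • X *ᵥ y - c 0 • X *ᵥ z) = 0 := by
      have : b • (c 1 • X *ᵥ y - c 0 • X *ᵥ z) + a • (c 0 • X *ᵥ y + c 1 • X *ᵥ z) = 0 := by
        rw [← h1]; module
      simpa [hc] using this
    have h3 := (smul_eq_zero.1 h2).resolve_left hb
    have h4 : (c 0 ^ 2 + c 1 ^ 2) • X *ᵥ y = 0 := by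
      have : (c 0 ^ 2 + c 1 ^ 2) • X *ᵥ y = c 0 • (c 0 • X *ᵥ y + c 1 • X *ᵥ z)
        + c 1 • (c 1 • X *ᵥ y - c 0 • X *ᵥ z) := by module
      rw [this, hc, h3]; simp
    have h5 : (c 0 ^ 2 + c 1 ^ 2) • X *ᵥ z = 0 := by
      have : (c 0 ^ 2 + c 1 ^ 2) • X *ᵥ z = c 1 • (c 0 • X *ᵥ y + c 1 • X *ᵥ z)
        - c 0 • (c 1 • X *ᵥ y - c 0 • X *ᵥ z) := by module
      rw [this, hc, h3]; simp
    have h6 : c 0 ^ 2 + c 1 ^ 2 = 0 := by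
      by_contra hc0
      exact hne ⟨(smul_eq_zero.1 h4).resolve_left hc0, (smul_eq_zero.1 h5).resolve_left hc0⟩
    have h7 : c 0 = 0 := by nlinarith [sq_nonneg (c 0), sq_nonneg (c 1)]
    have h8 : c 1 = 0 := by nlinarith [sq_nonneg (c 0), sq_nonneg (c 1)]
    ext i; fin_cases i
    · exact h7
    · exact h8
  · rw [mul_twoCol]
    exact fun h => hne (twoCol_eq_zero h)

theorem ofReal_mulVec_re {m : Type*} (M : Matrix m n ℝ) (v : n → ℂ) (i : m) :
    ((M.map Complex.ofReal *ᵥ v) i).re = (M *ᵥ fun j => (v j).re) i := by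
  simp [mulVec, dotProduct, Complex.re_sum]

theorem ofReal_mulVec_im {m : Type*} (M : Matrix m n ℝ) (v : n → ℂ) (i : m) :
    ((M.map Complex.ofReal *ᵥ v) i).im = (M *ᵥ fun j => (v j).im) i := by
  simp [mulVec, dotProduct, Complex.im_sum]

theorem ofReal_mulVec_eq_zero_iff {m : Type*} (M : Matrix m n ℝ) (v : n → ℂ) :
    M.map Complex.ofReal *ᵥ v = 0 ↔
      (M *ᵥ fun j => (v j).re) = 0 ∧ (M *ᵥ fun j => (v j).im) = 0 := by
  simp only [funext_iff, Complex.ext_iff, ofReal_mulVec_re, ofReal_mulVec_im, Pi.zero_apply,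
    Complex.zero_re, Complex.zero_im, forall_and]

theorem re_im_of_eigenvector {M : Matrix n n ℝ} {v : n → ℂ} {μ : ℂ}
    (h : M.map Complex.ofReal *ᵥ v = μ • v) :
    (M *ᵥ fun j => (v j).re) = μ.re • (fun j => (v j).re) - μ.im • (fun j => (v j).im) ∧
    (M *ᵥ fun j => (v j).im) = μ.im • (fun j => (v j).re) + μ.re • (fun j => (v j).im) := by
  constructor
  · ext i
    rw [← ofReal_mulVec_re, h]
    simp
  · ext i
    rw [← ofReal_mulVec_im, h]
    simp [add_comm]

theorem ofReal_mul {l m : Type*} (M : Matrix l n ℝ) (N : Matrix n m ℝ) :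
    (M * N).map Complex.ofReal = M.map Complex.ofReal * N.map Complex.ofReal :=
  Matrix.map_mul (f := Complex.ofRealHom)

theorem ofReal_add {l m : Type*} (M N : Matrix l m ℝ) :
    (M + N).map Complex.ofReal = M.map Complex.ofReal + N.map Complex.ofReal :=
  Matrix.map_add Complex.ofReal Complex.ofReal_add M N

theorem ofReal_sub {l m : Type*} (M N : Matrix l m ℝ) :
    (M - N).map Complex.ofReal = M.map Complex.ofReal - N.map Complex.ofReal :=
  Matrix.map_sub Complex.ofReal Complex.ofReal_sub M N

theorem ofReal_conjTranspose {l m : Type*} (M : Matrix l m ℝ) :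
    (M.map Complex.ofReal)ᴴ = Mᵀ.map Complex.ofReal := by
  ext i j
  simp

open scoped MatrixOrder ComplexOrder in
theorem ofReal_posSemidef [DecidableEq n] {M : Matrix n n ℝ} (h : M.PosSemidef) :
    (M.map Complex.ofReal).PosSemidef := by
  obtain ⟨L, rfl⟩ := CStarAlgebra.nonneg_iff_eq_star_mul_self.mp h.nonneg
  rw [ofReal_mul, star_eq_conjTranspose, conjTranspose_eq_transpose_of_trivial,
    ← ofReal_conjTranspose]
  exact posSemidef_conjTranspose_mul_self _

theorem exists_eigenvector_transpose [DecidableEq n] {M : Matrix n n ℂ} {μ : ℂ} {v : n → ℂ} (hv : v ≠ 0)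
    (h : M *ᵥ v = μ • v) : ∃ w : n → ℂ, w ≠ 0 ∧ Mᵀ *ᵥ w = μ • w := by
  have h0 : (M - μ • 1).det = 0 :=
    Matrix.exists_mulVec_eq_zero_iff.1 ⟨v, hv, by
      rw [sub_mulVec, smul_mulVec, one_mulVec, h, sub_self]⟩
  rw [← det_transpose] at h0
  obtain ⟨w, hw, hker⟩ := Matrix.exists_mulVec_eq_zero_iff.2 h0
  refine ⟨w, hw, ?_⟩
  rwa [transpose_sub, transpose_smul, transpose_one, sub_mulVec, smul_mulVec, one_mulVec,
    sub_eq_zero] at hker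

/-- Hautus test: a left eigenvector of `A` annihilated by `B` belongs to a stable eigenvalue. -/
theorem re_neg_of_stabilizable {n p : ℕ} {A : Matrix (Fin n) (Fin n) ℝ}
    {B : Matrix (Fin n) (Fin p) ℝ} (h : Stabilizable A B) {y : Fin n → ℂ} {μ : ℂ} (hy : y ≠ 0)
    (hA : Aᵀ.map Complex.ofReal *ᵥ y = μ • y) (hB : Bᵀ.map Complex.ofReal *ᵥ y = 0) :
    μ.re < 0 := by
  obtain ⟨F', hF⟩ := h
  have h1 : ((A + B * F').map Complex.ofReal)ᵀ *ᵥ y = μ • y := by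
    rw [← transpose_map, transpose_add, transpose_mul, ofReal_add, ofReal_mul, add_mulVec, hA,
      ← mulVec_mulVec, hB, mulVec_zero, add_zero]
  obtain ⟨w, hw, hw'⟩ := exists_eigenvector_transpose hy h1
  exact hF μ w hw hw'

theorem input_eq_zero {p : Type*} [Fintype p] [DecidableEq p] {B : Matrix n p ℝ}
    {R : Matrix p p ℝ} (hR : R.PosDef) {y : n → ℂ}
    (h : (B * R⁻¹ * Bᵀ).map Complex.ofReal *ᵥ y = 0) : Bᵀ.map Complex.ofReal *ᵥ y = 0 := by
  have key : ∀ x : n → ℝ, (B * R⁻¹ * Bᵀ) *ᵥ x = 0 → Bᵀ *ᵥ x = 0 := by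
    intro x hx
    by_contra hne
    have h1 := hR.inv.dotProduct_mulVec_pos hne
    have h2 : star (Bᵀ *ᵥ x) ⬝ᵥ R⁻¹ *ᵥ (Bᵀ *ᵥ x) = x ⬝ᵥ (B * R⁻¹ * Bᵀ) *ᵥ x := by
      rw [star_trivial, mulVec_transpose, ← dotProduct_mulVec, ← mulVec_transpose]
      simp [mulVec_mulVec, Matrix.mul_assoc]
    rw [h2, hx, dotProduct_zero] at h1
    exact lt_irrefl _ h1
  rw [ofReal_mulVec_eq_zero_iff] at h ⊢
  exact ⟨key _ h.1, key _ h.2⟩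

/-- A nonzero matrix whose range is stable under `N` yields an eigenvector of `N` in that
range. -/
theorem exists_eigenvector_in_range [DecidableEq n] {D N K : Matrix n n ℂ} (hD : D ≠ 0) (h : N * D = D * K) :
    ∃ (w : n → ℂ) (μ : ℂ), D *ᵥ w ≠ 0 ∧ N *ᵥ (D *ᵥ w) = μ • (D *ᵥ w) := by
  let P := LinearMap.range D.mulVecLin
  have hP : ∀ x ∈ P, N.mulVecLin x ∈ P := by
    rintro _ ⟨x, rfl⟩
    exact ⟨K *ᵥ x, by simp [mulVec_mulVec, h]⟩
  have : Nontrivial P := by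
    rw [Submodule.nontrivial_iff_ne_bot, Ne, LinearMap.range_eq_bot]
    intro h0
    exact hD (Matrix.ext_of_mulVec_single fun i => by
      rw [zero_mulVec]; exact LinearMap.congr_fun h0 _)
  obtain ⟨μ, hμ⟩ := Module.End.exists_eigenvalue (N.mulVecLin.restrict hP)
  obtain ⟨⟨_, w, rfl⟩, hx⟩ := hμ.exists_hasEigenvector
  refine ⟨w, μ, fun h0 => hx.2 (Subtype.ext h0), ?_⟩
  exact congr_arg Subtype.val hx.apply_eq_smul

/-- Lyapunov-type estimate at an eigenvector `H w` of `Nᴴ`. -/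
theorem two_re_mul_of_adjoint_eigenvector {H N : Matrix n n ℂ} (hH : H.IsHermitian)
    {w : n → ℂ} {μ : ℂ} (h : Nᴴ *ᵥ (H *ᵥ w) = μ • (H *ᵥ w)) :
    star w ⬝ᵥ (Nᴴ * H + H * N) *ᵥ w = (2 * μ.re : ℝ) * (star w ⬝ᵥ H *ᵥ w) := by
  have h1 : star w ⬝ᵥ (H * N) *ᵥ w = star μ * (star w ⬝ᵥ H *ᵥ w) := by
    have e : star w ᵥ* (H * N) = star μ • (star w ᵥ* H) := by
      have := congr_arg star h
      rw [star_mulVec, star_mulVec, conjTranspose_conjTranspose, hH.eq, star_smul,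
        star_mulVec, hH.eq] at this
      rw [← vecMul_vecMul, this]
    rw [dotProduct_mulVec, e, smul_dotProduct, ← dotProduct_mulVec, smul_eq_mul]
  rw [add_mulVec, dotProduct_add, h1, ← mulVec_mulVec, h, dotProduct_smul, smul_eq_mul,
    ← add_mul]
  congr 1
  exact Complex.add_conj μ

theorem two_re_mul_of_eigenvector {H N : Matrix n n ℂ} {w : n → ℂ} {μ : ℂ}
    (h : N *ᵥ w = μ • w) :
    star w ⬝ᵥ (Nᴴ * H + H * N) *ᵥ w = (2 * μ.re : ℝ) * (star w ⬝ᵥ H *ᵥ w) := by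
  have e : star w ᵥ* Nᴴ = star μ • star w := by rw [← star_mulVec, h, star_smul]
  rw [add_mulVec, dotProduct_add, ← mulVec_mulVec, ← mulVec_mulVec, h, dotProduct_mulVec, e,
    smul_dotProduct, mulVec_smul, dotProduct_smul, smul_eq_mul, smul_eq_mul, ← add_mul, add_comm]
  congr 1
  exact Complex.add_conj μ

theorem solvesARE_iff {n p : ℕ} {A : Matrix (Fin n) (Fin n) ℝ} {B : Matrix (Fin n) (Fin p) ℝ}
    {Q : Matrix (Fin n) (Fin n) ℝ} {R : Matrix (Fin p) (Fin p) ℝ}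
    {X : Matrix (Fin n) (Fin n) ℝ} :
    SolvesARE A B Q R X ↔ X * (B * R⁻¹ * Bᵀ) * X = X * A + Aᵀ * X + Q := by
  rw [SolvesARE, sub_sub, sub_sub, sub_eq_zero]
  simp only [Matrix.mul_assoc, add_assoc]

theorem riccati_add {S A Q X D : Matrix n n ℝ} (hX : X * S * X = X * A + Aᵀ * X + Q)
    (hD : D * S * D = (Aᵀ - X * S) * D + D * (A - S * X)) :
    (X + D) * S * (X + D) = (X + D) * A + Aᵀ * (X + D) + Q := by
  have : (X + D) * S * (X + D) = X * S * X + X * S * D + D * S * X + D * S * D := by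
    noncomm_ring
  rw [this, hX, hD]
  noncomm_ring

theorem riccati_sub {S A Q X D : Matrix n n ℝ} (hX : X * S * X = X * A + Aᵀ * X + Q)
    (hD : D * S * D = (X * S - Aᵀ) * D + D * (S * X - A)) :
    (X - D) * S * (X - D) = (X - D) * A + Aᵀ * (X - D) + Q := by
  have : (X - D) * S * (X - D) = X * S * X - X * S * D - D * S * X + D * S * D := by
    noncomm_ring
  rw [this, hX, hD]
  noncomm_ring

theorem exists_larger_solution {n p : ℕ} {A : Matrix (Fin n) (Fin n) ℝ}
    {B : Matrix (Fin n) (Fin p) ℝ} {Q : Matrix (Fin n) (Fin n) ℝ} {R : Matrix (Fin p) (Fin p) ℝ}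
    (hR : R.PosDef) (hstab : Stabilizable A B) {X : Matrix (Fin n) (Fin n) ℝ} (hXt : Xᵀ = X)
    (hX : SolvesARE A B Q R X) {v : Fin n → ℂ} {μ : ℂ} (hv : v ≠ 0) (hμ : 0 < μ.re)
    (hAv : (A - B * R⁻¹ * Bᵀ * X).map Complex.ofReal *ᵥ v = μ • v) :
    ∃ D : Matrix (Fin n) (Fin n) ℝ, D.PosSemidef ∧ D ≠ 0 ∧ SolvesARE A B Q R (X + D) := by
  have hS : (B * R⁻¹ * Bᵀ).PosSemidef := block_posSemidef hR B
  have hSt : (B * R⁻¹ * Bᵀ)ᵀ = B * R⁻¹ * Bᵀ := by simpa using hS.1.eq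
  simp only [solvesARE_iff] at hX ⊢
  obtain ⟨w, hw, hAw⟩ := exists_eigenvector_transpose hv hAv
  have hM : (A - B * R⁻¹ * Bᵀ * X)ᵀ = Aᵀ - X * (B * R⁻¹ * Bᵀ) := by
    rw [transpose_sub, transpose_mul, hXt, hSt]
  rw [← transpose_map, hM] at hAw
  obtain ⟨h1, h2⟩ := re_im_of_eigenvector hAw
  have hne := mt (ofReal_mulVec_eq_zero_iff (B * R⁻¹ * Bᵀ) w).2 fun h => by
    refine hμ.not_gt (re_neg_of_stabilizable hstab hw ?_ (input_eq_zero hR h))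
    rwa [ofReal_sub, sub_mulVec, ofReal_mul X, ← mulVec_mulVec, h, mulVec_zero, sub_zero] at hAw
  obtain ⟨D, hD, hD0, hDq⟩ := exists_quadratic_of_pair hS hμ h1 h2 hne
  refine ⟨D, hD, hD0, riccati_add hX ?_⟩
  rw [hDq, ← hM, transpose_transpose]

theorem exists_smaller_solution {n p : ℕ} {A : Matrix (Fin n) (Fin n) ℝ}
    {B : Matrix (Fin n) (Fin p) ℝ} {Q : Matrix (Fin n) (Fin n) ℝ} {R : Matrix (Fin p) (Fin p) ℝ}
    (hR : R.PosDef) {X : Matrix (Fin n) (Fin n) ℝ} (hXpos : X.PosSemidef)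
    (hX : SolvesARE A B Q R X) {v : Fin n → ℂ} {μ : ℂ}
    (hAv : A.map Complex.ofReal *ᵥ v = μ • v) (hQv : Q.map Complex.ofReal *ᵥ v = 0)
    (hXv : X.map Complex.ofReal *ᵥ v ≠ 0) :
    ∃ D : Matrix (Fin n) (Fin n) ℝ, D.PosSemidef ∧ D ≠ 0 ∧ (X - D).PosSemidef ∧
      SolvesARE A B Q R (X - D) := by
  have hXt : Xᵀ = X := by simpa using hXpos.1.eq
  have hSt : (B * R⁻¹ * Bᵀ)ᵀ = B * R⁻¹ * Bᵀ := by
    simpa using (block_posSemidef hR B).1.eq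
  simp only [solvesARE_iff] at hX ⊢
  obtain ⟨h1, h2⟩ := re_im_of_eigenvector hAv
  obtain ⟨h3, h4⟩ := (ofReal_mulVec_eq_zero_iff _ _).1 hQv
  obtain ⟨D, hD, hD0, hXD, hDq⟩ := exists_reduction_of_pair hXpos hX h1 h2 h3 h4
    (mt (ofReal_mulVec_eq_zero_iff _ _).2 hXv)
  refine ⟨D, hD, hD0, hXD, riccati_sub hX ?_⟩
  rw [hDq, transpose_sub, transpose_mul, transpose_transpose, hXt, hSt]

open scoped ComplexOrder in
/-- If two ordered symmetric solutions differ, the closed-loop matrix of the smaller one has an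
eigenvalue in the open right half-plane. -/
theorem exists_unstable_closedLoop_eigenvector {n p : ℕ} {A : Matrix (Fin n) (Fin n) ℝ}
    {B : Matrix (Fin n) (Fin p) ℝ} {Q : Matrix (Fin n) (Fin n) ℝ} {R : Matrix (Fin p) (Fin p) ℝ}
    (hR : R.PosDef) (hstab : Stabilizable A B) {X Y : Matrix (Fin n) (Fin n) ℝ} (hXt : Xᵀ = X)
    (hX : SolvesARE A B Q R X) (hY : SolvesARE A B Q R Y) (hXY : (Y - X).PosSemidef)
    (hne : X ≠ Y) :
    ∃ (v : Fin n → ℂ) (μ : ℂ), v ≠ 0 ∧ 0 < μ.re ∧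
      (A - B * R⁻¹ * Bᵀ * X).map Complex.ofReal *ᵥ v = μ • v := by
  rw [solvesARE_iff] at hX hY
  have hS : (B * R⁻¹ * Bᵀ).PosSemidef := block_posSemidef hR B
  have hSt : (B * R⁻¹ * Bᵀ)ᵀ = B * R⁻¹ * Bᵀ := by simpa using hS.1.eq
  set S := B * R⁻¹ * Bᵀ with hSdef
  set D := Y - X with hDdef
  set N := A - S * X with hNdef
  have hNt : Nᵀ = Aᵀ - X * S := by rw [hNdef, transpose_sub, transpose_mul, hXt, hSt]
  have hLyap : Nᵀ * D + D * N = D * S * D := by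
    have e : D * S * D = Y * S * Y - X * S * X - X * S * D - D * S * X := by
      rw [hDdef]; noncomm_ring
    rw [e, hX, hY, hNt, hNdef, hDdef]
    noncomm_ring
  have hD0 : D.map Complex.ofReal ≠ 0 := by
    intro h
    refine hne (sub_eq_zero.1 (?_ : D = 0)).symm
    ext i j
    exact Complex.ofReal_eq_zero.1 (congr_fun (congr_fun h i) j)
  have hinv : Nᵀ.map Complex.ofReal * D.map Complex.ofReal
      = D.map Complex.ofReal * (S * D - N).map Complex.ofReal := by
    rw [← ofReal_mul, ← ofReal_mul]
    rw [Matrix.mul_sub D, ← Matrix.mul_assoc, ← hLyap, add_sub_cancel_right]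
  obtain ⟨w, μ, hw, hμ⟩ := exists_eigenvector_in_range hD0 hinv
  have hDp := ofReal_posSemidef hXY
  have hq : 0 < star w ⬝ᵥ D.map Complex.ofReal *ᵥ w :=
    (hDp.dotProduct_mulVec_nonneg w).lt_of_ne' (mt (hDp.dotProduct_mulVec_zero_iff w).1 hw)
  have hest := two_re_mul_of_adjoint_eigenvector hDp.1 (N := N.map Complex.ofReal)
    (w := w) (μ := μ) (by rwa [ofReal_conjTranspose])
  have hSp := ofReal_posSemidef hS
  have hr : star w ⬝ᵥ (D * S * D).map Complex.ofReal *ᵥ w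
      = star (D.map Complex.ofReal *ᵥ w) ⬝ᵥ
        S.map Complex.ofReal *ᵥ (D.map Complex.ofReal *ᵥ w) := by
    rw [star_mulVec, hDp.1.eq, ← dotProduct_mulVec, ofReal_mul, ofReal_mul, ← mulVec_mulVec,
      ← mulVec_mulVec]
  rw [ofReal_conjTranspose, ← ofReal_mul, ← ofReal_mul, ← ofReal_add, hLyap, hr] at hest
  have hnn := hSp.dotProduct_mulVec_nonneg (D.map Complex.ofReal *ᵥ w)
  have hμpos : 0 < μ.re := by
    have h0 : 0 ≤ μ.re := by
      rw [hest] at hnn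
      have := (Complex.le_def.1 hnn).1
      rw [Complex.re_ofReal_mul] at this
      have hq' := (Complex.lt_def.1 hq).1
      simp only [Complex.zero_re] at this hq'
      nlinarith [nonneg_of_mul_nonneg_left this hq']
    refine h0.lt_of_ne fun h => ?_
    rw [← h, mul_zero, Complex.ofReal_zero, zero_mul, hSp.dotProduct_mulVec_zero_iff] at hest
    have hB := input_eq_zero hR hest
    rw [hNt, ofReal_sub, sub_mulVec, ofReal_mul X, ← mulVec_mulVec, hest, mulVec_zero,
      sub_zero] at hμ
    exact (re_neg_of_stabilizable hstab hw hμ hB).ne h.symm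
  obtain ⟨u, hu, hu'⟩ := exists_eigenvector_transpose hw hμ
  exact ⟨u, μ, hu, hμpos, by rwa [← transpose_map, transpose_transpose] at hu'⟩

open scoped ComplexOrder in
theorem undetectable_of_closedLoop_eigenvector {n p m : ℕ} {A : Matrix (Fin n) (Fin n) ℝ}
    {B : Matrix (Fin n) (Fin p) ℝ} {F : Matrix (Fin m) (Fin n) ℝ} {R : Matrix (Fin p) (Fin p) ℝ}
    (hR : R.PosDef) {X : Matrix (Fin n) (Fin n) ℝ} (hXp : X.PosSemidef)
    (hX : SolvesARE A B (Fᵀ * F) R X) {v : Fin n → ℂ} {μ : ℂ} (hμ : 0 < μ.re)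
    (hv : (A - B * R⁻¹ * Bᵀ * X).map Complex.ofReal *ᵥ v = μ • v) :
    A.map Complex.ofReal *ᵥ v = μ • v ∧ F.map Complex.ofReal *ᵥ v = 0 := by
  rw [solvesARE_iff] at hX
  have hS : (B * R⁻¹ * Bᵀ).PosSemidef := block_posSemidef hR B
  have hSt : (B * R⁻¹ * Bᵀ)ᵀ = B * R⁻¹ * Bᵀ := by simpa using hS.1.eq
  have hXt : Xᵀ = X := by simpa using hXp.1.eq
  set S := B * R⁻¹ * Bᵀ with hSdef
  set N := A - S * X with hNdef
  have hNt : Nᵀ = Aᵀ - X * S := by rw [hNdef, transpose_sub, transpose_mul, hXt, hSt]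
  have hLyap : Nᵀ * X + X * N = -(Fᵀ * F + X * S * X) := by
    have e : Nᵀ * X + X * N = X * A + Aᵀ * X - X * S * X - X * S * X := by
      rw [hNt, hNdef]; noncomm_ring
    rw [e, hX]; abel
  have hXc := ofReal_posSemidef hXp
  have hest := two_re_mul_of_eigenvector (H := X.map Complex.ofReal) hv
  have hFF : (Fᵀ * F).PosSemidef := by simpa using posSemidef_conjTranspose_mul_self F
  have hXSX : (X * S * X).PosSemidef := by
    simpa [hXt] using hS.conjTranspose_mul_mul_same X
  have hneg : (-(Fᵀ * F + X * S * X)).map Complex.ofReal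
      = -((Fᵀ * F).map Complex.ofReal + (X * S * X).map Complex.ofReal) := by
    ext i j; simp
  rw [ofReal_conjTranspose, ← ofReal_mul, ← ofReal_mul, ← ofReal_add, hLyap, hneg, neg_mulVec,
    add_mulVec, dotProduct_neg, dotProduct_add] at hest
  have h1 := (ofReal_posSemidef hFF).dotProduct_mulVec_nonneg v
  have h2 := (ofReal_posSemidef hXSX).dotProduct_mulVec_nonneg v
  have h3 := hXc.dotProduct_mulVec_nonneg v
  have hpos : (0 : ℂ) < (2 * μ.re : ℝ) := by exact_mod_cast (by positivity : 0 < 2 * μ.re)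
  have h4 := mul_nonneg hpos.le h3
  rw [← hest] at h4
  have hsum := le_antisymm (neg_nonneg.1 h4) (add_nonneg h1 h2)
  have hXv : X.map Complex.ofReal *ᵥ v = 0 := by
    rw [hsum, neg_zero] at hest
    exact (hXc.dotProduct_mulVec_zero_iff v).1
      ((mul_eq_zero.1 hest.symm).resolve_left hpos.ne')
  have hFv := ((add_eq_zero_iff_of_nonneg h1 h2).1 hsum).1
  constructor
  · rwa [hNdef, ofReal_sub, sub_mulVec, ofReal_mul S, ← mulVec_mulVec, hXv, mulVec_zero,
      sub_zero] at hv
  · rw [ofReal_mul, ← ofReal_conjTranspose, ← mulVec_mulVec, dotProduct_mulVec,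
      ← star_mulVec] at hFv
    exact dotProduct_star_self_eq_zero.1 hFv

end RiccatiGap

/-- **Gap between the smallest positive semidefinite and the maximal solution.**
Let `Q = FᵀF` be symmetric positive semidefinite, `R` symmetric positive definite and
`(A, B)` stabilizable. If `X₋` is a smallest positive semidefinite solution and `X₊` a
maximal (symmetric) solution of the ARE, then `X₋ = X₊` iff there is no nonzero
`(A, F)`-undetectable eigenvector of `A` for an eigenvalue in the open right half-plane,
i.e. no `v ≠ 0` and `λ` with `Re λ > 0`, `Av = λv` and `Fv = 0`. -/
theorem smallest_psd_eq_maximal_iff (n p m : ℕ)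
    (A : Matrix (Fin n) (Fin n) ℝ) (B : Matrix (Fin n) (Fin p) ℝ)
    (F : Matrix (Fin m) (Fin n) ℝ)
    (Q : Matrix (Fin n) (Fin n) ℝ) (hQ : Q.PosSemidef) (hQF : Q = Fᵀ * F)
    (R : Matrix (Fin p) (Fin p) ℝ) (hR : R.PosDef)
    (hstab : Stabilizable A B)
    (Xm : Matrix (Fin n) (Fin n) ℝ)
    (hXm : Xm.PosSemidef ∧ SolvesARE A B Q R Xm ∧
      ∀ X : Matrix (Fin n) (Fin n) ℝ, X.PosSemidef → SolvesARE A B Q R X →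
        (X - Xm).PosSemidef)
    (Xp : Matrix (Fin n) (Fin n) ℝ)
    (hXp : Xpᵀ = Xp ∧ SolvesARE A B Q R Xp ∧
      ∀ X : Matrix (Fin n) (Fin n) ℝ, Xᵀ = X → SolvesARE A B Q R X →
        (Xp - X).PosSemidef) :
    Xm = Xp ↔
      ¬∃ (v : Fin n → ℂ) (lam : ℂ), v ≠ 0 ∧ 0 < lam.re ∧
        (A.map (Complex.ofReal)) *ᵥ v = lam • v ∧ (F.map (Complex.ofReal)) *ᵥ v = 0 := by
  have hXmt : Xmᵀ = Xm := by simpa using hXm.1.1.eq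
  constructor
  · rintro rfl ⟨v, μ, hv, hμ, hAv, hFv⟩
    by_cases hXv : Xm.map Complex.ofReal *ᵥ v = 0
    · obtain ⟨D, hD, hD0, hsol⟩ := RiccatiGap.exists_larger_solution hR hstab hXmt hXm.2.1 hv hμ
        (by rw [RiccatiGap.ofReal_sub, sub_mulVec, RiccatiGap.ofReal_mul _ Xm, ← mulVec_mulVec,
          hXv, mulVec_zero, sub_zero, hAv])
      have hDt : Dᵀ = D := by simpa using hD.1.eq
      have h := hXp.2.2 (Xm + D) (by rw [transpose_add, hXmt, hDt]) hsol
      rw [sub_add_cancel_left] at h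
      exact hD0 (RiccatiGap.eq_zero_of_posSemidef_of_neg hD h)
    · obtain ⟨D, hD, hD0, hpos, hsol⟩ := RiccatiGap.exists_smaller_solution hR hXm.1 hXm.2.1 hAv
        (by rw [hQF, RiccatiGap.ofReal_mul, ← mulVec_mulVec, hFv, mulVec_zero]) hXv
      have h := hXm.2.2 (Xm - D) hpos hsol
      rw [sub_sub_cancel_left] at h
      exact hD0 (RiccatiGap.eq_zero_of_posSemidef_of_neg hD h)
  · intro hno
    by_contra hne
    obtain ⟨v, μ, hv, hμ, hN⟩ := RiccatiGap.exists_unstable_closedLoop_eigenvector hR hstab hXmt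
      hXm.2.1 hXp.2.1 (hXp.2.2 Xm hXmt hXm.2.1) hne
    obtain ⟨hA, hF⟩ := RiccatiGap.undetectable_of_closedLoop_eigenvector hR hXm.1
      (hQF ▸ hXm.2.1) hμ hN
    exact hno ⟨v, μ, hv, hμ, hA, hF⟩
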